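/- arXiv:2310.18784 — 3 statements merged into one kernel-verified Lean document; each statement's English description precedes it below -/
import Mathlib

section
/- Let Ψ : ℝ^d → ℝ^d be a component-wise nonlinearity with scalar function N, and let the noise vector z satisfy the noise assumption with density p. Let φ_i(x) = E[N(x + z_i)] (expectation over the i-th coordinate z_i of the noise), let φ'(0) = min_{1≤i≤d} φ_i'(0) > 0, and let Φ(x) = (φ_1(x_1), …, φ_d(x_d)). Then there exists a constant ξ > 0, depending only on the nonlinearity and the noise, such that for every x ∈ ℝ^d: ⟨Φ(x), x⟩ ≥ (φ'(0)/2) · min{ ξ‖x‖/√d , ‖x‖²/d }. -/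
open MeasureTheory Real
open scoped ENNReal RealInnerProductSpace

open Filter Topology in
/-- A monotone function vanishing at the origin with positive slope `c` there satisfies
`f u * u ≥ c / 2 * min (ξ * |u|) (u ^ 2)` for all sufficiently small `ξ > 0`. -/
theorem Monotone.eventually_min_le_mul_self_of_hasDerivAt {f : ℝ → ℝ} {c : ℝ} (hf : Monotone f)
    (hf0 : f 0 = 0) (hc : 0 < c) (hd : HasDerivAt f c 0) :
    ∀ᶠ ξ in 𝓝[>] (0 : ℝ), ∀ u, c / 2 * min (ξ * |u|) (u ^ 2) ≤ f u * u := by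
  have hnear : ∀ᶠ u in 𝓝 (0 : ℝ), c / 2 * u ^ 2 ≤ f u * u := by
    filter_upwards [(hasDerivAt_iff_isLittleO.1 hd).def (half_pos hc)] with u hu
    simp only [hf0, sub_zero, smul_eq_mul, Real.norm_eq_abs] at hu
    have h : |(f u - u * c) * u| ≤ c / 2 * u ^ 2 := by
      rw [abs_mul, ← sq_abs u]
      nlinarith [mul_le_mul_of_nonneg_right hu (abs_nonneg u)]
    nlinarith [(abs_le.1 h).1]
  obtain ⟨ε, hε, hball⟩ := Metric.eventually_nhds_iff.1 hnear
  filter_upwards [Ioo_mem_nhdsGT hε] with ξ ⟨hξ, hξε⟩ u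
  have hsmall : ∀ w, |w| ≤ ξ → c / 2 * w ^ 2 ≤ f w * w := fun w hw =>
    hball (by simpa [Real.dist_eq] using hw.trans_lt hξε)
  have hlin : ξ ≤ |u| → c / 2 * (ξ * |u|) ≤ f u * u := by
    intro hu
    rcases le_abs.1 hu with h | h
    · have h1 : c / 2 * ξ ≤ f ξ := le_of_mul_le_mul_right
        (by linarith [hsmall ξ (abs_of_pos hξ).le]) hξ
      rw [abs_of_pos (hξ.trans_le h)]
      nlinarith [hf h]
    · have h1 : c / 2 * ξ ≤ -f (-ξ) := le_of_mul_le_mul_right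
        (by linarith [hsmall (-ξ) (by rw [abs_neg, abs_of_pos hξ])]) hξ
      rw [abs_of_neg (by linarith)]
      nlinarith [hf (show u ≤ -ξ by linarith)]
  rcases le_total |u| ξ with hu | hu
  · exact (mul_le_mul_of_nonneg_left (min_le_right _ _) (half_pos hc).le).trans (hsmall u hu)
  · exact (mul_le_mul_of_nonneg_left (min_le_left _ _) (half_pos hc).le).trans (hlin hu)

/-- A measure with an even (not necessarily measurable) density with respect to a
reflection-invariant measure is reflection-invariant. -/
theorem MeasureTheory.Measure.map_neg_withDensity_of_even {E : Type*} [AddGroup E]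
    [MeasurableSpace E] [MeasurableNeg E] (μ : Measure E) [μ.IsNegInvariant] {g : E → ℝ≥0∞}
    (hg : ∀ u, g (-u) = g u) : (μ.withDensity g).map Neg.neg = μ.withDensity g := by
  ext s hs
  rw [Measure.map_apply measurable_neg hs, withDensity_apply _ (measurable_neg hs),
    withDensity_apply _ hs, ← (Measure.measurePreserving_neg μ).setLIntegral_comp_preimage_emb
      (MeasurableEquiv.neg E).measurableEmbedding g s]
  simp only [hg]

/-- An odd function has zero integral against a reflection-invariant measure. -/
theorem MeasureTheory.integral_eq_zero_of_odd {E : Type*} [AddGroup E]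
    [MeasurableSpace E] [MeasurableNeg E] {ν : Measure E} (hν : ν.map Neg.neg = ν) {g : E → ℝ}
    (hg : ∀ u, g (-u) = -g u) : ∫ u, g u ∂ν = 0 := by
  have h : ∫ u, g u ∂ν = ∫ u, g (-u) ∂ν := by
    conv_lhs => rw [← hν]
    exact (MeasurableEquiv.neg E).measurableEmbedding.integral_map g
  simp only [hg, integral_neg] at h
  linarith

/-- Convolving a bounded monotone function with a random variable preserves monotonicity. -/
theorem Monotone.integral_add_of_bounded {Ω : Type*} [MeasurableSpace Ω] {P : Measure Ω}
    [IsFiniteMeasure P] {f : ℝ → ℝ} {C : ℝ} (hf : Monotone f) (hC : ∀ u, |f u| ≤ C)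
    {X : Ω → ℝ} (hX : Measurable X) : Monotone fun u => ∫ ω, f (u + X ω) ∂P := by
  have hint : ∀ u, Integrable (fun ω => f (u + X ω)) P := fun u =>
    .of_bound (hf.measurable.comp (hX.const_add u)).aestronglyMeasurable C
      (ae_of_all _ fun ω => hC _)
  exact fun a b hab => integral_mono (hint a) (hint b) fun ω => hf (by linarith)

/-- Some coordinate of a Euclidean vector is at least its quadratic mean. -/
theorem EuclideanSpace.exists_norm_div_sqrt_card_le_abs {d : ℕ} (hd : 0 < d)
    (v : EuclideanSpace ℝ (Fin d)) : ∃ i, ‖v‖ / √d ≤ |v i| := by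
  have : Nonempty (Fin d) := ⟨⟨0, hd⟩⟩
  obtain ⟨i, -, hi⟩ := Finset.exists_max_image Finset.univ (fun i => |v i|)
    Finset.univ_nonempty
  refine ⟨i, ?_⟩
  rw [div_le_iff₀ (by positivity), EuclideanSpace.norm_eq]
  refine Real.sqrt_le_iff.2 ⟨by positivity, ?_⟩
  rw [mul_pow, Real.sq_sqrt (by positivity)]
  calc ∑ j, ‖v j‖ ^ 2 ≤ ∑ _j : Fin d, |v i| ^ 2 := Finset.sum_le_sum fun j hj =>
        pow_le_pow_left₀ (norm_nonneg _) (hi j hj) 2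
    _ = |v i| ^ 2 * d := by simp [mul_comm]

/-- Lemma 3: lower bound on the inner product between the
denoised component-wise nonlinearity and its argument. -/
theorem denoised_componentwise_inner_product_lower_bound
    {d : ℕ} (hd : 0 < d)
    {Ω : Type*} [MeasurableSpace Ω] (P : Measure Ω) [IsProbabilityMeasure P]
    -- the component-wise nonlinearity
    (Ψ : EuclideanSpace ℝ (Fin d) → EuclideanSpace ℝ (Fin d))
    (Nf : ℝ → ℝ) (C₁ : ℝ) (hC₁ : 0 < C₁)
    (hΨ : ∀ v i, Ψ v i = Nf (v i))
    (hN_cont : ∀ᵐ u : ℝ ∂volume, ContinuousAt Nf u)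
    (hN_pwdiff : ∃ S : Set ℝ, S.Countable ∧ ∀ u ∉ S, DifferentiableAt ℝ Nf u)
    (hN_mono : Monotone Nf)
    (hN_odd : ∀ u, Nf (-u) = - Nf u)
    (hN_bdd : ∀ u, |Nf u| ≤ C₁)
    (hN_zero : ¬ ContinuousAt Nf 0
      ∨ ∃ c₁ > (0:ℝ), StrictMonoOn Nf (Set.Ioo (-c₁) c₁))
    -- the noise vector, its density and the noise assumption
    (z : Ω → EuclideanSpace ℝ (Fin d))
    (p : EuclideanSpace ℝ (Fin d) → ℝ) (B₀ : ℝ) (hB₀ : 0 < B₀)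
    (hz_meas : Measurable z)
    (hz_int : Integrable z P)
    (hz_mean : ∫ ω, z ω ∂P = 0)
    (hz_law : Measure.map z P = volume.withDensity fun u => ENNReal.ofReal (p u))
    (hp_symm : ∀ u, p (-u) = p u)
    (hp_pos : ∀ u, ‖u‖ ≤ B₀ → 0 < p u)
    -- the denoised scalar maps φ_i, their derivatives at zero, φ'(0), and Φ
    (φ : Fin d → ℝ → ℝ)
    (hφ : ∀ i u, φ i u = ∫ ω, Nf (u + z ω i) ∂P)
    (φd : Fin d → ℝ)
    (hφd : ∀ i, HasDerivAt (φ i) (φd i) 0)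
    (hφd_pos : ∀ i, 0 < φd i)
    (φ0 : ℝ) (hφ0 : φ0 = ⨅ i, φd i)
    (Φ : EuclideanSpace ℝ (Fin d) → EuclideanSpace ℝ (Fin d))
    (hΦ : ∀ v i, Φ v i = φ i (v i)) :
    ∃ ξ > (0:ℝ), ∀ v : EuclideanSpace ℝ (Fin d),
      φ0 / 2 * min (ξ * ‖v‖ / Real.sqrt d) (‖v‖ ^ 2 / d) ≤ ⟪Φ v, v⟫ := by
  have hν : (P.map z).map Neg.neg = P.map z := by
    rw [hz_law]
    exact Measure.map_neg_withDensity_of_even volume fun u => by rw [hp_symm]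
  have hcoord : ∀ i, Measurable fun u : EuclideanSpace ℝ (Fin d) => u i := fun i =>
    (EuclideanSpace.proj i : EuclideanSpace ℝ (Fin d) →L[ℝ] ℝ).measurable
  have hφ_zero : ∀ i, φ i 0 = 0 := by
    intro i
    have hmap := integral_map (μ := P) hz_meas.aemeasurable
      (hN_mono.measurable.comp (hcoord i)).aestronglyMeasurable
    simp only [hφ, zero_add]
    exact hmap.symm.trans (integral_eq_zero_of_odd hν fun u => by simp [hN_odd])
  have hφ_mono : ∀ i, Monotone (φ i) := by
    intro i
    rw [funext (hφ i)]
    exact hN_mono.integral_add_of_bounded hN_bdd ((hcoord i).comp hz_meas)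
  have hφ0_le : ∀ i, φ0 ≤ φd i := fun i => hφ0 ▸ ciInf_le (Set.finite_range φd).bddBelow i
  have hφ0_nonneg : 0 ≤ φ0 := hφ0 ▸ Real.iInf_nonneg fun i => (hφd_pos i).le
  obtain ⟨ξ, hbound, hξ⟩ := ((Filter.eventually_all.2 fun i =>
    (hφ_mono i).eventually_min_le_mul_self_of_hasDerivAt (hφ_zero i) (hφd_pos i) (hφd i)).and
      self_mem_nhdsWithin).exists
  have hterm : ∀ i u, φ0 / 2 * min (ξ * |u|) (u ^ 2) ≤ φ i u * u := fun i u =>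
    (mul_le_mul_of_nonneg_right (by linarith [hφ0_le i]) (by positivity)).trans (hbound i u)
  refine ⟨ξ, hξ, fun v => ?_⟩
  obtain ⟨i, hi⟩ := EuclideanSpace.exists_norm_div_sqrt_card_le_abs hd v
  have hinner : ⟪Φ v, v⟫ = ∑ j, φ j (v j) * v j := by
    simp [PiLp.inner_apply, hΦ, mul_comm]
  rw [hinner]
  have hsq : ‖v‖ ^ 2 / d = (‖v‖ / √d) ^ 2 := by
    rw [div_pow, Real.sq_sqrt (Nat.cast_nonneg d)]
  calc φ0 / 2 * min (ξ * ‖v‖ / √d) (‖v‖ ^ 2 / d)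
      ≤ φ0 / 2 * min (ξ * |v i|) (v i ^ 2) := by
        rw [hsq, mul_div_assoc, ← sq_abs (v i)]
        gcongr
    _ ≤ φ i (v i) * v i := hterm i _
    _ ≤ ∑ j, φ j (v j) * v j := Finset.single_le_sum (f := fun j => φ j (v j) * v j)
        (fun j _ => le_trans (by positivity) (hterm j (v j))) (Finset.mem_univ i)
end

section
/- Let d ≥ 1 be an integer, let c, ξ > 0, and let φ_1, …, φ_d : ℝ → ℝ be odd, non-decreasing functions satisfying φ_i(x) ≥ (c/2)·min{x, ξ} for every x ≥ 0 and every i. Then for every x ∈ ℝ^d: Σ_{i=1}^d x_i·φ_i(x_i) ≥ (c/2)·min{ ξ‖x‖_∞ , ‖x‖_∞² } ≥ (c/2)·min{ ξ‖x‖/√d , ‖x‖²/d }, where ‖x‖ is the Euclidean norm and ‖x‖_∞ = max_i |x_i|. -/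
/-- An odd function bounded below by `c / 2 * min u ξ` on `u ≥ 0` satisfies
`c / 2 * min (ξ * |u|) (|u| ^ 2) ≤ u * f u` everywhere. -/
theorem mul_min_abs_le_mul_of_odd {f : ℝ → ℝ} {c ξ : ℝ} (hodd : ∀ u, f (-u) = -f u)
    (hlb : ∀ u : ℝ, 0 ≤ u → c / 2 * min u ξ ≤ f u) (u : ℝ) :
    c / 2 * min (ξ * |u|) (|u| ^ 2) ≤ u * f u := by
  have habs : u * f u = |u| * f |u| := by
    rcases abs_choice u with h | h <;> rw [h]
    rw [hodd, neg_mul_neg]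
  have hmin : min (ξ * |u|) (|u| ^ 2) = |u| * min |u| ξ := by
    rw [mul_min_of_nonneg _ _ (abs_nonneg u), min_comm, sq, mul_comm ξ]
  calc c / 2 * min (ξ * |u|) (|u| ^ 2) = |u| * (c / 2 * min |u| ξ) := by rw [hmin]; ring
    _ ≤ |u| * f |u| := mul_le_mul_of_nonneg_left (hlb _ (abs_nonneg u)) (abs_nonneg u)
    _ = u * f u := habs.symm

/-- The Euclidean norm is at most `√d` times any bound on the coordinates. -/
theorem EuclideanSpace.norm_le_sqrt_mul_of_abs_le {d : ℕ} (x : EuclideanSpace ℝ (Fin d))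
    {M : ℝ} (hM : 0 ≤ M) (h : ∀ i, |x i| ≤ M) : ‖x‖ ≤ √d * M := by
  rw [← Real.sqrt_sq hM, ← Real.sqrt_mul (Nat.cast_nonneg d), EuclideanSpace.norm_eq]
  refine Real.sqrt_le_sqrt ?_
  calc ∑ i, ‖x i‖ ^ 2 ≤ ∑ _i : Fin d, M ^ 2 :=
        Finset.sum_le_sum fun i _ => pow_le_pow_left₀ (norm_nonneg _) (h i) 2
    _ = d * M ^ 2 := by simp

/-- the coordinate-wise lower bounds on the `φ_i` yield a
lower bound on `Σ_i x_i φ_i(x_i)` in terms of the sup norm and the Euclidean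
norm. -/
theorem componentwise_sum_lower_bound
    {d : ℕ} (hd : 0 < d) (c ξ : ℝ) (hc : 0 < c) (hξ : 0 < ξ)
    (φ : Fin d → ℝ → ℝ)
    (hodd : ∀ i u, φ i (-u) = - φ i u)
    (hmono : ∀ i, Monotone (φ i))
    (hlb : ∀ i, ∀ u : ℝ, 0 ≤ u → c / 2 * min u ξ ≤ φ i u) :
    ∀ x : EuclideanSpace ℝ (Fin d),
      let M := Finset.univ.sup'
        (Finset.univ_nonempty_iff.mpr (Fin.pos_iff_nonempty.mp hd))
        (fun i => |x i|)
      c / 2 * min (ξ * ‖x‖ / Real.sqrt d) (‖x‖ ^ 2 / d)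
          ≤ c / 2 * min (ξ * M) (M ^ 2)
        ∧ c / 2 * min (ξ * M) (M ^ 2) ≤ ∑ i, x i * φ i (x i) := by
  intro x M
  have hne : (Finset.univ : Finset (Fin d)).Nonempty :=
    Finset.univ_nonempty_iff.mpr (Fin.pos_iff_nonempty.mp hd)
  obtain ⟨j, -, hj⟩ : ∃ j ∈ Finset.univ, M = |x j| :=
    Finset.exists_mem_eq_sup' hne fun i => |x i|
  have hle : ∀ i, |x i| ≤ M := fun i =>
    Finset.le_sup' (fun i => |x i|) (Finset.mem_univ i)
  have hM : 0 ≤ M := hj ▸ abs_nonneg (x j)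
  have hd' : (0 : ℝ) < d := Nat.cast_pos.mpr hd
  have hsqrt : 0 < √(d : ℝ) := Real.sqrt_pos.mpr hd'
  have hnorm : ‖x‖ ≤ √d * M := EuclideanSpace.norm_le_sqrt_mul_of_abs_le x hM hle
  have hterm i := mul_min_abs_le_mul_of_odd (hodd i) (hlb i) (x i)
  constructor
  · refine mul_le_mul_of_nonneg_left (min_le_min ?_ ?_) (by positivity)
    · rw [div_le_iff₀ hsqrt, mul_assoc, mul_comm M]
      exact mul_le_mul_of_nonneg_left hnorm hξ.le
    · rw [div_le_iff₀ hd']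
      calc ‖x‖ ^ 2 ≤ (√d * M) ^ 2 := pow_le_pow_left₀ (norm_nonneg x) hnorm 2
        _ = M ^ 2 * d := by rw [mul_pow, Real.sq_sqrt hd'.le, mul_comm]
  · have hnonneg : ∀ i ∈ Finset.univ, 0 ≤ x i * φ i (x i) := fun i _ =>
      le_trans (by positivity) (hterm i)
    rw [hj]
    exact (hterm j).trans (Finset.single_le_sum hnonneg (Finset.mem_univ j))
end

section
/- Define g(z) = 1/((z² + 1)·log²(|z| + 2)) for z ∈ ℝ. Then: (i) g is Lebesgue-integrable on ℝ, so c = 1/∫_ℝ g(z) dz is a well-defined positive normalizing constant making ρ(z) = c·g(z) a probability density; (ii) ρ has a finite first absolute moment, ∫_ℝ |z| ρ(z) dz < ∞; and (iii) for every η ∈ (1, 2], ∫_ℝ |z|^η ρ(z) dz = ∞. -/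
open MeasureTheory Real
open scoped ENNReal

theorem log_abs_add_two_ge (u : ℝ) : Real.log 2 ≤ Real.log (|u| + 2) :=
  Real.log_le_log two_pos (by linarith [abs_nonneg u])

theorem log_abs_add_two_pos (u : ℝ) : 0 < Real.log (|u| + 2) :=
  (Real.log_pos one_lt_two).trans_le (log_abs_add_two_ge u)

theorem continuous_log_abs_add_two : Continuous fun u : ℝ => Real.log (|u| + 2) :=
  Continuous.log (by fun_prop) fun u => by positivity

theorem integrableOn_Ioi_inv_mul_log_sq :
    IntegrableOn (fun x : ℝ => ((x + 2) * Real.log (x + 2) ^ 2)⁻¹) (Set.Ioi 0) := by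
  have hlog (x : ℝ) (hx : 0 ≤ x) : 0 < Real.log (x + 2) := Real.log_pos (by linarith)
  refine integrableOn_Ioi_deriv_of_nonneg' (g := fun x => -(Real.log (x + 2))⁻¹) (l := -0)
    (fun x hx => ?_) (fun x hx => ?_) ?_
  · have hx : (0 : ℝ) ≤ x := hx
    have h := ((((hasDerivAt_id x).add_const 2).log (by simp; linarith)).inv (hlog x hx).ne').neg
    refine h.congr_deriv ?_
    have := (hlog x hx).ne'
    simp only [id]
    field_simp
  · have hx : (0 : ℝ) < x := hx
    positivity
  · exact (Real.tendsto_log_atTop.comp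
      (Filter.tendsto_atTop_add_const_right _ 2 Filter.tendsto_id)).inv_tendsto_atTop.neg

theorem integrable_inv_abs_mul_log_sq :
    Integrable (fun x : ℝ => ((|x| + 2) * Real.log (|x| + 2) ^ 2)⁻¹) := by
  have h : IntegrableOn (fun x : ℝ => ((|x| + 2) * Real.log (|x| + 2) ^ 2)⁻¹) (Set.Ioi 0) :=
    integrableOn_Ioi_inv_mul_log_sq.congr_fun
      (fun x hx => by simp only [abs_of_pos (show (0 : ℝ) < x from hx)]) measurableSet_Ioi
  have hneg := IntegrableOn.comp_neg_Iio (c := (0 : ℝ)) (by simpa only [neg_zero] using h)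
  simp only [abs_neg] at hneg
  rw [← integrableOn_univ, ← Set.Iic_union_Ioi (a := (0 : ℝ))]
  exact ((integrableOn_Iic_iff_integrableOn_Iio enorm_ne_top).2 hneg).union h

theorem continuous_inv_sq_add_one_mul_log_sq :
    Continuous fun u : ℝ => 1 / ((u ^ 2 + 1) * Real.log (|u| + 2) ^ 2) :=
  continuous_const.div ((by fun_prop : Continuous fun u : ℝ => u ^ 2 + 1).mul
    (continuous_log_abs_add_two.pow 2)) fun u => by
      have := log_abs_add_two_pos u
      positivity

theorem integrable_inv_sq_add_one_mul_log_sq :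
    Integrable fun u : ℝ => 1 / ((u ^ 2 + 1) * Real.log (|u| + 2) ^ 2) := by
  refine (integrable_inv_one_add_sq.mul_const ((Real.log 2 ^ 2)⁻¹)).mono'
    continuous_inv_sq_add_one_mul_log_sq.aestronglyMeasurable (ae_of_all _ fun u => ?_)
  have h2 : 0 < Real.log 2 := Real.log_pos one_lt_two
  have hu := log_abs_add_two_ge u
  rw [Real.norm_of_nonneg (by positivity), one_div, ← mul_inv, add_comm]
  gcongr

theorem integrable_abs_mul_inv_sq_add_one_mul_log_sq :
    Integrable fun u : ℝ => |u| * (1 / ((u ^ 2 + 1) * Real.log (|u| + 2) ^ 2)) := by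
  refine (integrable_inv_abs_mul_log_sq.const_mul 3).mono'
    (continuous_abs.mul continuous_inv_sq_add_one_mul_log_sq).aestronglyMeasurable
    (ae_of_all _ fun u => ?_)
  have hu := log_abs_add_two_pos u
  rw [Real.norm_of_nonneg (by positivity), mul_one_div, ← div_eq_mul_inv,
    div_le_div_iff₀ (by positivity) (by positivity), ← mul_assoc, ← mul_assoc]
  refine mul_le_mul_of_nonneg_right ?_ (sq_nonneg _)
  nlinarith [sq_abs u, sq_nonneg (|u| - 1)]

theorem not_integrable_abs_rpow_mul_inv_sq_add_one_mul_log_sq {η : ℝ} (hη : 1 < η) :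
    ¬ Integrable fun u : ℝ => |u| ^ η * (1 / ((u ^ 2 + 1) * Real.log (|u| + 2) ^ 2)) := by
  intro h
  set ε := (η - 1) / 2 with hε
  have hε0 : 0 < ε := by linarith
  refine not_integrableOn_Ioi_inv (a := 1)
    ((h.integrableOn.const_mul (2 * (3 ^ ε / ε) ^ 2)).mono' measurable_inv.aestronglyMeasurable
      ((ae_restrict_iff' measurableSet_Ioi).2 (ae_of_all _ fun x hx => ?_)))
  have hx : (1 : ℝ) < x := hx
  have hx0 : 0 < x := by linarith
  have hlog : Real.log (x + 2) ≤ 3 ^ ε / ε * x ^ ε := by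
    calc Real.log (x + 2) ≤ (x + 2) ^ ε / ε := Real.log_le_rpow_div (by linarith) hε0
      _ ≤ (3 * x) ^ ε / ε := by gcongr; linarith
      _ = 3 ^ ε / ε * x ^ ε := by rw [Real.mul_rpow (by norm_num) hx0.le]; ring
  have hpos : 0 < Real.log (x + 2) := Real.log_pos (by linarith)
  have hpow : x ^ η = x * (x ^ ε) ^ 2 := by
    rw [← Real.rpow_natCast, ← Real.rpow_mul hx0.le, ← Real.rpow_one_add' hx0.le] <;>
      push_cast <;> [(congr 1; linarith); linarith]
  rw [Real.norm_of_nonneg (by positivity), abs_of_pos hx0, mul_one_div, ← mul_div_assoc,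
    inv_eq_one_div, div_le_div_iff₀ hx0 (by positivity), one_mul, hpow]
  calc (x ^ 2 + 1) * Real.log (x + 2) ^ 2 ≤ (2 * x ^ 2) * (3 ^ ε / ε * x ^ ε) ^ 2 := by
        gcongr
        nlinarith
    _ = _ := by ring

/-- Example 2: the density proportional to
`1/((z²+1)·log²(|z|+2))` has a finite first absolute moment but infinite
`η`-th moments for every `η ∈ (1,2]`. -/
theorem log_density_moments
    (g : ℝ → ℝ)
    (hg : ∀ u : ℝ, g u = 1 / ((u ^ 2 + 1) * Real.log (|u| + 2) ^ 2)) :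
    -- (i) g is integrable and normalizable to a probability density
    Integrable g ∧ (0 < ∫ u : ℝ, g u) ∧
    (∀ c : ℝ, ∀ ρ : ℝ → ℝ, c = (∫ u : ℝ, g u)⁻¹ → (∀ u, ρ u = c * g u) →
      (∫ u : ℝ, ρ u) = 1 ∧
      -- (ii) finite first absolute moment
      (∫⁻ u : ℝ, ENNReal.ofReal (|u| * ρ u)) < ⊤ ∧
      -- (iii) infinite η-th moments for η ∈ (1,2]
      (∀ η : ℝ, 1 < η → η ≤ 2 →
        (∫⁻ u : ℝ, ENNReal.ofReal (|u| ^ η * ρ u)) = ⊤)) := by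
  obtain rfl : g = _ := funext hg
  have hpos : 0 < ∫ u : ℝ, 1 / ((u ^ 2 + 1) * Real.log (|u| + 2) ^ 2) :=
    integral_pos_of_integrable_nonneg_nonzero (x := 0) continuous_inv_sq_add_one_mul_log_sq
      integrable_inv_sq_add_one_mul_log_sq (fun u => by positivity)
      (by have := log_abs_add_two_pos 0; positivity)
  refine ⟨integrable_inv_sq_add_one_mul_log_sq, hpos, fun c ρ hc hρ => ?_⟩
  obtain rfl : ρ = _ := funext hρ
  have hc0 : 0 < c := hc ▸ inv_pos.2 hpos
  refine ⟨?_, ?_, fun η hη _ => ?_⟩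
  · rw [integral_const_mul, hc, inv_mul_cancel₀ hpos.ne']
  · simp only [mul_left_comm _ c]
    exact (integrable_abs_mul_inv_sq_add_one_mul_log_sq.const_mul c).lintegral_lt_top
  · simp only [mul_left_comm _ c]
    by_contra htop
    have hcont : Continuous fun u : ℝ =>
        c * (|u| ^ η * (1 / ((u ^ 2 + 1) * Real.log (|u| + 2) ^ 2))) :=
      continuous_const.mul ((continuous_abs.rpow_const fun _ => Or.inr (by linarith)).mul
        continuous_inv_sq_add_one_mul_log_sq)
    have hmoment := (lintegral_ofReal_ne_top_iff_integrable hcont.aestronglyMeasurable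
      (ae_of_all _ fun u => mul_nonneg hc0.le (by positivity))).1 htop
    rw [integrable_const_mul_iff hc0.ne'.isUnit] at hmoment
    exact not_integrable_abs_rpow_mul_inv_sq_add_one_mul_log_sq hη hmoment
end
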